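/- arXiv:0904.1984 — 3 statements merged into one kernel-verified Lean document; each statement's English description precedes it below -/
import Mathlib

section
/- Let $n\ge 2$ and $1\le k\le n$ be integers, $h\in\mathbb{R}$, $c>0$, and let $g:(a_1,a_2)\to\mathbb{R}$ be differentiable with $g(t)>\sqrt{c}$, $g'(t)\ne 0$, and $(g'(t))^2 = c - g(t)^2 + g(t)^2\,(h+g(t)^{-n})^2$ for all $t$. Set $\lambda = h+g^{-n}$, $r = g/\sqrt{c}$, fix $t_0\in(a_1,a_2)$ and let $\theta(t)=\int_{t_0}^t \frac{r(\tau)\lambda(\tau)}{r(\tau)^2-1}\,d\tau$. Let $B_2(s)\in\mathbb{R}^{n+2}$ be the vector with $\cosh s$ in coordinate $k$, $\sinh s$ in coordinate $k+1$ and $0$ elsewhere, and $B_3(s)$ the vector with $\sinh s$ in coordinate $k$, $\cosh s$ in coordinate $k+1$ and $0$ elsewhere. Then $(r')^2 - r^2\lambda^2 = 1 - r^2$ on $(a_1,a_2)$, and for every $y\in\mathbb{R}^{n+2}$ with $y_k=y_{k+1}=0$ and $\langle y,y\rangle = 1$, the curves $\phi(u) = r(u)\,y + \sqrt{r(u)^2-1}\,B_2(\theta(u))$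 and $\nu(u) = -r(u)\lambda(u)\,y - \frac{r(u)^2\lambda(u)}{\sqrt{r(u)^2-1}}\,B_2(\theta(u)) - \frac{r'(u)}{\sqrt{r(u)^2-1}}\,B_3(\theta(u))$ satisfy: $\langle\phi,\phi\rangle\equiv 1$, $\langle\phi',\phi'\rangle\equiv 1$, $\langle\nu,\nu\rangle\equiv -1$, $\langle\nu,\phi'\rangle\equiv 0$, $\langle\nu(u),v\rangle = 0$ for every $v\in\mathbb{R}^{n+2}$ with $v_k=v_{k+1}=0$ and $\langle v,y\rangle = 0$, and $\nu'(u) = -(nh-(n-1)\lambda(u))\,\phi'(u)$ for all $u$. -/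
/-- The semi-riemannian bilinear form of index `k` on `ℝ^m`:
`⟨v,w⟩ = -v₁w₁ - ⋯ - v_k w_k + v_{k+1} w_{k+1} + ⋯ + v_m w_m`
(coordinates are 0-indexed in Lean, so the first `k` indices carry sign `-1`). -/
noncomputable def semiForm (k : ℕ) {m : ℕ} (v w : Fin m → ℝ) : ℝ :=
  ∑ i : Fin m, (if (i : ℕ) < k then (-1 : ℝ) else 1) * v i * w i

section SemiForm

variable {m : ℕ} (k : ℕ)

lemma semiForm_comm (v w : Fin m → ℝ) : semiForm k v w = semiForm k w v :=
  Finset.sum_congr rfl fun _ _ => by ring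

lemma semiForm_add_left (v₁ v₂ w : Fin m → ℝ) :
    semiForm k (v₁ + v₂) w = semiForm k v₁ w + semiForm k v₂ w := by
  simp only [semiForm, ← Finset.sum_add_distrib, Pi.add_apply]
  exact Finset.sum_congr rfl fun _ _ => by ring

lemma semiForm_smul_left (a : ℝ) (v w : Fin m → ℝ) :
    semiForm k (a • v) w = a * semiForm k v w := by
  simp only [semiForm, Finset.mul_sum, Pi.smul_apply, smul_eq_mul]
  exact Finset.sum_congr rfl fun _ _ => by ring

lemma semiForm_add_right (v w₁ w₂ : Fin m → ℝ) :
    semiForm k v (w₁ + w₂) = semiForm k v w₁ + semiForm k v w₂ := by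
  rw [semiForm_comm, semiForm_add_left, semiForm_comm k w₁, semiForm_comm k w₂]

lemma semiForm_smul_right (a : ℝ) (v w : Fin m → ℝ) :
    semiForm k v (a • w) = a * semiForm k v w := by
  rw [semiForm_comm, semiForm_smul_left, semiForm_comm]

lemma semiForm_single_right (v : Fin m → ℝ) (i : Fin m) :
    semiForm k v (Pi.single i 1) = (if (i : ℕ) < k then (-1 : ℝ) else 1) * v i := by
  simp only [semiForm, Pi.single_apply, mul_ite, mul_one, mul_zero, Finset.sum_ite_eq',
    Finset.mem_univ, if_true]

/-- The form on sums of a vector orthogonal to a hyperbolic plane and a combination of the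
pseudo-orthonormal pair `b₂, b₃` of that plane. -/
lemma semiForm_combination {v w b₂ b₃ : Fin m → ℝ}
    (h₂ : semiForm k b₂ b₂ = -1) (h₃ : semiForm k b₃ b₃ = 1) (h₂₃ : semiForm k b₂ b₃ = 0)
    (hv₂ : semiForm k v b₂ = 0) (hv₃ : semiForm k v b₃ = 0)
    (hw₂ : semiForm k w b₂ = 0) (hw₃ : semiForm k w b₃ = 0) (a p q a' p' q' : ℝ) :
    semiForm k (a • v + p • b₂ + q • b₃) (a' • w + p' • b₂ + q' • b₃) =
      a * a' * semiForm k v w - p * p' + q * q' := by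
  simp only [semiForm_add_left, semiForm_add_right, semiForm_smul_left, semiForm_smul_right,
    semiForm_comm k b₂ w, semiForm_comm k b₃ w, semiForm_comm k b₃ b₂, h₂, h₃, h₂₃, hv₂, hv₃,
    hw₂, hw₃]
  ring

end SemiForm

/-- If a nowhere vanishing derivative `f'` satisfies `f' ^ 2 = Q` with `Q` differentiable, then
`f'` is differentiable. -/
lemma hasDerivAt_deriv_of_sq_eq {a b : ℝ} {f Q : ℝ → ℝ}
    (hf : ∀ t ∈ Set.Ioo a b, DifferentiableAt ℝ f t) (hf0 : ∀ t ∈ Set.Ioo a b, deriv f t ≠ 0)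
    (hsq : ∀ t ∈ Set.Ioo a b, deriv f t ^ 2 = Q t) {u Q' : ℝ} (hu : u ∈ Set.Ioo a b)
    (hQ : HasDerivAt Q Q' u) : HasDerivAt (deriv f) (Q' / (2 * deriv f u)) u := by
  have hnhds : Set.Ioo a b ∈ nhds u := isOpen_Ioo.mem_nhds hu
  have hQu : Q u ≠ 0 := by rw [← hsq u hu]; exact pow_ne_zero 2 (hf0 u hu)
  have hs := hQ.sqrt hQu
  rcases hasDerivWithinAt_forall_lt_or_forall_gt_of_forall_ne (convex_Ioo a b)
    (fun t ht => (hf t ht).hasDerivAt.hasDerivWithinAt) hf0 with hneg | hpos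
  · have key : ∀ t ∈ Set.Ioo a b, deriv f t = -√(Q t) := fun t ht => by
      rw [← hsq t ht, Real.sqrt_sq_eq_abs, abs_of_neg (hneg t ht), neg_neg]
    rw [key u hu, mul_neg, div_neg]
    exact hs.fun_neg.congr_of_eventuallyEq (Filter.eventually_of_mem hnhds key)
  · have key : ∀ t ∈ Set.Ioo a b, deriv f t = √(Q t) := fun t ht => by
      rw [← hsq t ht, Real.sqrt_sq_eq_abs, abs_of_pos (hpos t ht)]
    rw [key u hu]
    exact hs.congr_of_eventuallyEq (Filter.eventually_of_mem hnhds key)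

/-- Fundamental theorem of calculus on an open interval where the integrand is continuous. -/
lemma hasDerivAt_integral_of_continuousOn_Ioo {a b t₀ u : ℝ} {f : ℝ → ℝ}
    (hf : ContinuousOn f (Set.Ioo a b)) (ht₀ : t₀ ∈ Set.Ioo a b) (hu : u ∈ Set.Ioo a b) :
    HasDerivAt (fun t => ∫ x in t₀..t, f x) (f u) u :=
  intervalIntegral.integral_hasDerivAt_right
    (hf.mono (Set.ordConnected_Ioo.uIcc_subset ht₀ hu)).intervalIntegrable
    (hf.stronglyMeasurableAtFilter isOpen_Ioo u hu) (hf.continuousAt (isOpen_Ioo.mem_nhds hu))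

/-- Theorem 2.4 of the paper (first family of cmc hypersurfaces of `𝕊_k^{n+1}`).
Coordinates `k` and `k+1` of the paper (1-indexed) are indices `k-1` and `k` here. -/
theorem stmt_3 (n k : ℕ) (hn : 2 ≤ n) (hk1 : 1 ≤ k) (hkn : k ≤ n)
    (h c a₁ a₂ t₀ : ℝ) (hc : 0 < c) (ht₀ : t₀ ∈ Set.Ioo a₁ a₂)
    (g lam r θ : ℝ → ℝ)
    (hgdiff : ∀ t ∈ Set.Ioo a₁ a₂, DifferentiableAt ℝ g t)
    (hgc : ∀ t ∈ Set.Ioo a₁ a₂, Real.sqrt c < g t)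
    (hg' : ∀ t ∈ Set.Ioo a₁ a₂, deriv g t ≠ 0)
    (hode : ∀ t ∈ Set.Ioo a₁ a₂,
      deriv g t ^ 2 = c - g t ^ 2 + g t ^ 2 * (h + g t ^ (-(n : ℤ))) ^ 2)
    (hlam : ∀ t, lam t = h + g t ^ (-(n : ℤ)))
    (hr : ∀ t, r t = g t / Real.sqrt c)
    (hθ : ∀ t, θ t = ∫ τ in t₀..t, r τ * lam τ / (r τ ^ 2 - 1))
    (B₂ B₃ : ℝ → Fin (n + 2) → ℝ)
    (hB₂ : ∀ s i, B₂ s i =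
      if (i : ℕ) = k - 1 then Real.cosh s else if (i : ℕ) = k then Real.sinh s else 0)
    (hB₃ : ∀ s i, B₃ s i =
      if (i : ℕ) = k - 1 then Real.sinh s else if (i : ℕ) = k then Real.cosh s else 0) :
    (∀ t ∈ Set.Ioo a₁ a₂, deriv r t ^ 2 - r t ^ 2 * lam t ^ 2 = 1 - r t ^ 2) ∧
    ∀ y : Fin (n + 2) → ℝ,
      (∀ i : Fin (n + 2), ((i : ℕ) = k - 1 ∨ (i : ℕ) = k) → y i = 0) →
      semiForm k y y = 1 →
      ∀ φ ν : ℝ → Fin (n + 2) → ℝ,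
        (∀ u, φ u = r u • y + Real.sqrt (r u ^ 2 - 1) • B₂ (θ u)) →
        (∀ u, ν u = (-(r u * lam u)) • y
            - (r u ^ 2 * lam u / Real.sqrt (r u ^ 2 - 1)) • B₂ (θ u)
            - (deriv r u / Real.sqrt (r u ^ 2 - 1)) • B₃ (θ u)) →
        ∀ u ∈ Set.Ioo a₁ a₂,
          semiForm k (φ u) (φ u) = 1 ∧
          semiForm k (deriv φ u) (deriv φ u) = 1 ∧
          semiForm k (ν u) (ν u) = -1 ∧
          semiForm k (ν u) (deriv φ u) = 0 ∧
          (∀ v : Fin (n + 2) → ℝ,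
            (∀ i : Fin (n + 2), ((i : ℕ) = k - 1 ∨ (i : ℕ) = k) → v i = 0) →
            semiForm k v y = 0 → semiForm k (ν u) v = 0) ∧
          deriv ν u = (-((n : ℝ) * h - ((n : ℝ) - 1) * lam u)) • deriv φ u := by
  have hsc : 0 < √c := Real.sqrt_pos.2 hc
  have hscsq : √c ^ 2 = c := Real.sq_sqrt hc.le
  have hgpos : ∀ t ∈ Set.Ioo a₁ a₂, 0 < g t := fun t ht => hsc.trans (hgc t ht)
  have hr1 : ∀ t ∈ Set.Ioo a₁ a₂, 1 < r t := fun t ht => by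
    rw [hr, one_lt_div hsc]; exact hgc t ht
  have hrd : ∀ t ∈ Set.Ioo a₁ a₂, HasDerivAt r (deriv g t / √c) t := fun t ht => by
    rw [funext hr]; exact (hgdiff t ht).hasDerivAt.div_const _
  have hlamd : ∀ t ∈ Set.Ioo a₁ a₂,
      HasDerivAt lam (-(n : ℝ) * (lam t - h) * deriv r t / r t) t := fun t ht => by
    have hg0 := (hgpos t ht).ne'
    have hd := ((hasDerivAt_zpow (-(n : ℤ)) (g t) (Or.inl hg0)).comp t
      (hgdiff t ht).hasDerivAt).const_add h
    rw [(hrd t ht).deriv, hlam t, hr t, funext hlam]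
    refine hd.congr_deriv ?_
    rw [zpow_sub_one₀ hg0]
    push_cast
    field_simp
    ring
  have hode_r : ∀ t ∈ Set.Ioo a₁ a₂,
      deriv r t ^ 2 = 1 - r t ^ 2 + r t ^ 2 * lam t ^ 2 := fun t ht => by
    rw [(hrd t ht).deriv, hr, hlam, div_pow, div_pow, hode t ht, hscsq]
    field_simp
  refine ⟨fun t ht => by rw [hode_r t ht]; ring, fun y hy hyy φ ν hφ hν u hu => ?_⟩
  have hrdiff : ∀ t ∈ Set.Ioo a₁ a₂, HasDerivAt r (deriv r t) t := fun t ht =>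
    (hrd t ht).differentiableAt.hasDerivAt
  have hr'0 : ∀ t ∈ Set.Ioo a₁ a₂, deriv r t ≠ 0 := fun t ht => by
    rw [(hrd t ht).deriv]; exact div_ne_zero (hg' t ht) hsc.ne'
  have hθd : HasDerivAt θ (r u * lam u / (r u ^ 2 - 1)) u := by
    rw [funext hθ]
    refine hasDerivAt_integral_of_continuousOn_Ioo
      (f := fun τ => r τ * lam τ / (r τ ^ 2 - 1)) (fun t ht => ?_) ht₀ hu
    refine ContinuousAt.continuousWithinAt (ContinuousAt.div
      ((hrdiff t ht).continuousAt.mul (hlamd t ht).continuousAt)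
      (((hrdiff t ht).continuousAt.pow 2).sub continuousAt_const) ?_)
    nlinarith [hr1 t ht]
  have hru := hr1 u hu
  have hr0 : r u ≠ 0 := by linarith
  have hp0 := hr'0 u hu
  have hSpos : 0 < r u ^ 2 - 1 := by nlinarith
  have hs0 : √(r u ^ 2 - 1) ≠ 0 := (Real.sqrt_pos.2 hSpos).ne'
  have hssq : √(r u ^ 2 - 1) ^ 2 = r u ^ 2 - 1 := Real.sq_sqrt hSpos.le
  have hodeu := hode_r u hu
  have hrD := hrdiff u hu
  have hlamD := hlamd u hu
  have hrlam : HasDerivAt (fun t => r t * lam t)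
      (((n : ℝ) * h - ((n : ℝ) - 1) * lam u) * deriv r u) u := by
    refine (hrD.fun_mul hlamD).congr_deriv ?_
    field_simp
    ring
  have hsD : HasDerivAt (fun t => √(r t ^ 2 - 1)) (r u * deriv r u / √(r u ^ 2 - 1)) u := by
    refine (((hrD.fun_pow 2).sub_const 1).sqrt hSpos.ne').congr_deriv ?_
    push_cast
    field_simp
  have hr'D : HasDerivAt (deriv r)
      (r u * lam u * ((n : ℝ) * h - ((n : ℝ) - 1) * lam u) - r u) u := by
    refine (hasDerivAt_deriv_of_sq_eq (fun t ht => (hrdiff t ht).differentiableAt) hr'0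
      (Q := fun t => 1 - r t ^ 2 + (r t * lam t) ^ 2)
      (fun t ht => by rw [hode_r t ht]; ring) hu
      (((hrD.fun_pow 2).const_sub 1).fun_add (hrlam.fun_pow 2))).congr_deriv ?_
    push_cast
    field_simp
    ring
  have hB₂D : ∀ s, HasDerivAt B₂ (B₃ s) s := fun s => hasDerivAt_pi.2 fun i => by
    simp only [hB₂, hB₃]
    split_ifs
    exacts [Real.hasDerivAt_cosh s, Real.hasDerivAt_sinh s, hasDerivAt_const s 0]
  have hB₃D : ∀ s, HasDerivAt B₃ (B₂ s) s := fun s => hasDerivAt_pi.2 fun i => by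
    simp only [hB₂, hB₃]
    split_ifs
    exacts [Real.hasDerivAt_sinh s, Real.hasDerivAt_cosh s, hasDerivAt_const s 0]
  have hB₂θ : HasDerivAt (fun t => B₂ (θ t)) _ u := (hB₂D (θ u)).scomp u hθd
  have hB₃θ : HasDerivAt (fun t => B₃ (θ t)) _ u := (hB₃D (θ u)).scomp u hθd
  generalize hm : (n : ℝ) * h - ((n : ℝ) - 1) * lam u = M at *
  generalize hs : √(r u ^ 2 - 1) = S at *
  have hφ' : deriv φ u = deriv r u • y + (r u * deriv r u / S) • B₂ (θ u)
      + (r u * lam u / S) • B₃ (θ u) := by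
    rw [funext hφ, ((hrD.smul_const y).fun_add (hsD.fun_smul hB₂θ)).deriv, hs, ← hssq]
    ext i
    simp only [Pi.add_apply, Pi.smul_apply, smul_eq_mul]
    field_simp
    ring
  have hν' : deriv ν u = (-M) • deriv φ u := by
    have hνfun : ν = fun t => (-(r t * lam t)) • y
        - (r t * (r t * lam t) / √(r t ^ 2 - 1)) • B₂ (θ t)
        - (deriv r t / √(r t ^ 2 - 1)) • B₃ (θ t) := by
      funext t; rw [hν, sq (r t), mul_assoc]
    have hS0 : √(r u ^ 2 - 1) ≠ 0 := hs ▸ hs0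
    have c₂ : ((deriv r u * (r u * lam u) + r u * (M * deriv r u)) * S
        - r u * (r u * lam u) * (r u * deriv r u / S)) / S ^ 2
        + deriv r u / S * (r u * lam u / S ^ 2) = M * (r u * deriv r u / S) := by
      field_simp
      linear_combination lam u * hssq
    have c₃ : r u * (r u * lam u) / S * (r u * lam u / S ^ 2)
        + ((r u * lam u * M - r u) * S - deriv r u * (r u * deriv r u / S)) / S ^ 2
        = M * (r u * lam u / S) := by
      field_simp
      linear_combination -hssq - hodeu
    rw [hφ', hνfun, (((hrlam.fun_neg.smul_const y).fun_sub
      (((hrD.fun_mul hrlam).fun_div hsD hS0).fun_smul hB₂θ)).fun_sub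
      ((hr'D.fun_div hsD hS0).fun_smul hB₃θ)).deriv, hs, ← hssq]
    ext i
    simp only [Pi.add_apply, Pi.sub_apply, Pi.smul_apply, smul_eq_mul]
    linear_combination -B₂ (θ u) i * c₂ - B₃ (θ u) i * c₃
  have hν'' : ν u = (-(r u * lam u)) • y + (-(r u ^ 2 * lam u / S)) • B₂ (θ u)
      + (-(deriv r u / S)) • B₃ (θ u) := by
    rw [hν, hs]; module
  have hφ'' : φ u = r u • y + S • B₂ (θ u) + (0 : ℝ) • B₃ (θ u) := by
    rw [hφ, hs]; module
  obtain ⟨i₀, hi₀⟩ : ∃ i : Fin (n + 2), (i : ℕ) = k - 1 := ⟨⟨k - 1, by omega⟩, rfl⟩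
  obtain ⟨i₁, hi₁⟩ : ∃ i : Fin (n + 2), (i : ℕ) = k := ⟨⟨k, by omega⟩, rfl⟩
  have hpair : ∀ (w : Fin (n + 2) → ℝ) (p q : ℝ) (b : Fin (n + 2) → ℝ),
      (∀ i : Fin (n + 2), b i = if (i : ℕ) = k - 1 then p else if (i : ℕ) = k then q else 0) →
      semiForm k w b = -(w i₀ * p) + w i₁ * q := fun w p q b hb => by
    have hne : i₀ ≠ i₁ := fun e => by rw [e] at hi₀; omega
    have : b = p • Pi.single i₀ 1 + q • Pi.single i₁ 1 := by
      ext i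
      have e₀ : (i : ℕ) = k - 1 ↔ i = i₀ := by rw [← hi₀, Fin.ext_iff]
      have e₁ : (i : ℕ) = k ↔ i = i₁ := by rw [← hi₁, Fin.ext_iff]
      simp only [hb, e₀, e₁, Pi.add_apply, Pi.smul_apply, Pi.single_apply, smul_eq_mul]
      split_ifs <;> simp_all
    have hlt : (i₀ : ℕ) < k := by omega
    have hnlt : ¬ (i₁ : ℕ) < k := by omega
    rw [this, semiForm_add_right, semiForm_smul_right, semiForm_smul_right,
      semiForm_single_right, semiForm_single_right, if_pos hlt, if_neg hnlt]
    ring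
  have hk0 : k ≠ k - 1 := by omega
  have hcs := Real.cosh_sq_sub_sinh_sq (θ u)
  have h₂ : semiForm k (B₂ (θ u)) (B₂ (θ u)) = -1 := by
    rw [hpair _ _ _ _ (hB₂ (θ u)), hB₂, hB₂, if_pos hi₀, if_neg (hi₁ ▸ hk0), if_pos hi₁]
    linear_combination -hcs
  have h₃ : semiForm k (B₃ (θ u)) (B₃ (θ u)) = 1 := by
    rw [hpair _ _ _ _ (hB₃ (θ u)), hB₃, hB₃, if_pos hi₀, if_neg (hi₁ ▸ hk0), if_pos hi₁]
    linear_combination hcs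
  have h₂₃ : semiForm k (B₂ (θ u)) (B₃ (θ u)) = 0 := by
    rw [hpair _ _ _ _ (hB₃ (θ u)), hB₂, hB₂, if_pos hi₀, if_neg (hi₁ ▸ hk0), if_pos hi₁]
    ring
  have hperp : ∀ w : Fin (n + 2) → ℝ,
      (∀ i : Fin (n + 2), ((i : ℕ) = k - 1 ∨ (i : ℕ) = k) → w i = 0) →
      semiForm k w (B₂ (θ u)) = 0 ∧ semiForm k w (B₃ (θ u)) = 0 := fun w hw => by
    rw [hpair _ _ _ _ (hB₂ (θ u)), hpair _ _ _ _ (hB₃ (θ u)), hw i₀ (Or.inl hi₀),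
      hw i₁ (Or.inr hi₁)]
    simp
  obtain ⟨hy₂, hy₃⟩ := hperp y hy
  have hcomb := semiForm_combination k h₂ h₃ h₂₃ hy₂ hy₃ hy₂ hy₃
  refine ⟨?_, ?_, ?_, ?_, fun v hv hvy => ?_, hν'⟩
  · rw [hφ'', hcomb, hyy]
    linear_combination -hssq
  · rw [hφ', hcomb, hyy]
    field_simp
    linear_combination (deriv r u ^ 2 - 1) * hssq - hodeu
  · rw [hν'', hcomb, hyy]
    field_simp
    linear_combination (1 + r u ^ 2 * lam u ^ 2) * hssq + hodeu
  · rw [hν'', hφ', hcomb, hyy]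
    field_simp
    linear_combination -(r u * lam u * deriv r u) * hssq
  · obtain ⟨hv₂, hv₃⟩ := hperp v hv
    have := semiForm_combination k h₂ h₃ h₂₃ hy₂ hy₃ hv₂ hv₃ (-(r u * lam u))
      (-(r u ^ 2 * lam u / S)) (-(deriv r u / S)) 1 0 0
    rw [semiForm_comm k y v, hvy] at this
    simpa [hν''] using this
end

section
/- Let $n\ge 3$ be an integer and let $h\in[-1,\ -2\sqrt{n-1}/n)$. Then there exist a real number $c>0$ and a nonconstant differentiable function $g:\mathbb{R}\to\mathbb{R}$ such that $g(t)>\sqrt{c}$ for all $t\in\mathbb{R}$ and $(g'(t))^2 = c - g(t)^2 + g(t)^2\,(h+g(t)^{-n})^2$ for all $t\in\mathbb{R}$. Moreover, if $h>-1$, then $g$ can be chosen to be periodic. -/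
/-- A positive, bounded, continuous function `f` has a global surjective solution of `y' = f y`;
if `f` is periodic, then `y` is equivariant under a time shift. -/
theorem exists_surjective_hasDerivAt_of_bounded {f : ℝ → ℝ} (hf : Continuous f)
    (hpos : ∀ x, 0 < f x) {M : ℝ} (hM : ∀ x, f x ≤ M) :
    ∃ y : ℝ → ℝ, Function.Surjective y ∧ (∀ t, HasDerivAt y (f (y t)) t) ∧
      ∀ P > 0, Function.Periodic f P → ∃ T > 0, ∀ t, y (t + T) = y t + P := by
  have hinv : Continuous fun x => (f x)⁻¹ := hf.inv₀ fun x => (hpos x).ne'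
  set S : ℝ → ℝ := fun x => ∫ s in (0 : ℝ)..x, (f s)⁻¹ with hS
  have hSd : ∀ x, HasDerivAt S (f x)⁻¹ x := fun x =>
    hinv.integral_hasStrictDerivAt 0 x |>.hasDerivAt
  have hS0 : S 0 = 0 := by simp [hS]
  have hMpos : 0 < M := (hpos 0).trans_le (hM 0)
  have hSmono : StrictMono S := strictMono_of_deriv_pos fun x => by
    rw [(hSd x).deriv]; exact inv_pos.2 (hpos x)
  have hcont : Continuous S := continuous_iff_continuousAt.2 fun x => (hSd x).continuousAt
  have hd : ∀ x, HasDerivAt (fun x => S x - M⁻¹ * x) ((f x)⁻¹ - M⁻¹ * 1) x := fun x =>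
    (hSd x).sub ((hasDerivAt_id x).const_mul _)
  have hmono : Monotone fun x => S x - M⁻¹ * x := by
    refine monotone_of_deriv_nonneg (fun x => (hd x).differentiableAt) fun x => ?_
    rw [(hd x).deriv, mul_one, sub_nonneg]
    exact inv_anti₀ (hpos x) (hM x)
  have hMi : 0 < M⁻¹ := inv_pos.2 hMpos
  have htop : Filter.Tendsto S Filter.atTop Filter.atTop := by
    refine Filter.tendsto_atTop_mono' _ ?_ (Filter.tendsto_id.const_mul_atTop hMi)
    filter_upwards [Filter.eventually_ge_atTop 0] with x hx
    have := hmono hx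
    simp only [hS0, mul_zero, id] at this ⊢
    linarith
  have hbot : Filter.Tendsto S Filter.atBot Filter.atBot := by
    refine Filter.tendsto_atBot_mono' _ ?_ (Filter.tendsto_id.const_mul_atBot hMi)
    filter_upwards [Filter.eventually_le_atBot 0] with x hx
    have := hmono hx
    simp only [hS0, mul_zero, id] at this ⊢
    linarith
  have hsurj : Function.Surjective S := hcont.surjective htop hbot
  let e := hSmono.orderIsoOfSurjective S hsurj
  have hSe : ∀ t, S (e.symm t) = t := fun t => e.apply_symm_apply t
  have heS : ∀ x, e.symm (S x) = x := fun x => e.symm_apply_apply x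
  refine ⟨e.symm, e.symm.surjective, fun t => ?_, fun P hP hper => ?_⟩
  · have := (hSd (e.symm t)).of_local_left_inverse e.symm.continuous.continuousAt
      (inv_ne_zero (hpos _).ne') (Filter.Eventually.of_forall hSe)
    simpa using this
  · refine ⟨S P, by simpa [hS0] using hSmono hP, fun t => ?_⟩
    have hadd : S (e.symm t + P) = t + S P := by
      have h1 : Function.Periodic (fun x => (f x)⁻¹) P := fun x => by simp [hper x]
      have h2 := h1.intervalIntegral_add_eq (e.symm t) 0
      have h3 := intervalIntegral.integral_add_adjacent_intervals
        (hinv.intervalIntegrable (μ := MeasureTheory.volume) 0 (e.symm t))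
        (hinv.intervalIntegrable (e.symm t) (e.symm t + P))
      have h4 := hSe t
      simp only [hS, zero_add] at h2 h3 h4 ⊢
      linarith
    rw [← hadd, heS]

/-- If `q` is positive between two simple zeros, then `(g')² = q g` has a nonconstant periodic
solution oscillating between them. -/
theorem exists_periodic_deriv_sq_eq {q : ℝ → ℝ} {U : Set ℝ} {a b qa qb : ℝ} (hab : a < b)
    (hU : Set.Icc a b ⊆ U) (hUo : IsOpen U) (hq : ContinuousOn q U)
    (ha : q a = 0) (hb : q b = 0) (hpos : ∀ v ∈ Set.Ioo a b, 0 < q v)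
    (hda : HasDerivAt q qa a) (hqa : 0 < qa) (hdb : HasDerivAt q qb b) (hqb : qb < 0) :
    ∃ g : ℝ → ℝ, Differentiable ℝ g ∧ (¬ ∃ k : ℝ, ∀ t, g t = k) ∧ (∀ t, g t ∈ Set.Icc a b) ∧
      (∀ t, deriv g t ^ 2 = q (g t)) ∧ ∃ T > 0, Function.Periodic g T := by
  have haU : U ∈ nhds a := hUo.mem_nhds (hU ⟨le_rfl, hab.le⟩)
  have hbU : U ∈ nhds b := hUo.mem_nhds (hU ⟨hab.le, le_rfl⟩)
  set Q := dslope q a with hQ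
  have hqQ : ∀ v, q v = (v - a) * Q v := fun v => by
    have := sub_smul_dslope q a v
    rw [ha, sub_zero, smul_eq_mul] at this
    exact this.symm
  have hQc : ContinuousOn Q U := (continuousOn_dslope haU).2 ⟨hq, hda.differentiableAt⟩
  have hQd : DifferentiableAt ℝ Q b :=
    (differentiableAt_dslope_of_ne hab.ne').2 hdb.differentiableAt
  have hQa : Q a = qa := by rw [hQ, dslope_same, hda.deriv]
  have hQb : Q b = 0 := by
    have := hqQ b
    rw [hb, eq_comm, mul_eq_zero] at this
    exact this.resolve_left (sub_pos.2 hab).ne'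
  have hQ' : deriv Q b < 0 := by
    have h1 : HasDerivAt (fun v => (v - a) * Q v) (1 * Q b + (b - a) * deriv Q b) b :=
      ((hasDerivAt_id b).sub_const a).mul hQd.hasDerivAt
    have h2 := h1.unique (hdb.congr_of_eventuallyEq
      (Filter.Eventually.of_forall fun v => (hqQ v).symm))
    rw [hQb] at h2
    by_contra! h3
    nlinarith [mul_nonneg (sub_pos.2 hab).le h3]
  set p : ℝ → ℝ := fun v => -dslope Q b v with hp
  have hpc : ContinuousOn p U := ((continuousOn_dslope hbU).2 ⟨hQc, hQd⟩).neg
  have hqp : ∀ v, q v = (v - a) * (b - v) * p v := fun v => by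
    have := sub_smul_dslope Q b v
    rw [hQb, sub_zero, smul_eq_mul] at this
    rw [hqQ v, ← this, hp]
    ring
  have hppos : ∀ v ∈ Set.Icc a b, 0 < p v := by
    intro v hv
    rcases hv.1.eq_or_lt with rfl | hav
    · have := sub_smul_dslope Q b a
      rw [hQb, sub_zero, smul_eq_mul, hQa] at this
      have h1 : 0 < (b - a) * p a := by simp only [hp]; linarith
      exact pos_of_mul_pos_right h1 (sub_pos.2 hab).le
    rcases hv.2.eq_or_lt with rfl | hvb
    · simp only [hp, dslope_same]; linarith
    · have h1 := hpos v ⟨hav, hvb⟩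
      rw [hqp] at h1
      exact pos_of_mul_pos_right h1 (mul_pos (sub_pos.2 hav) (sub_pos.2 hvb)).le
  set w : ℝ → ℝ := fun θ => (a + b) / 2 - (b - a) / 2 * Real.cos θ with hw
  have hwI : ∀ θ, w θ ∈ Set.Icc a b := fun θ => by
    have h1 := Real.neg_one_le_cos θ
    have h2 := Real.cos_le_one θ
    constructor <;> simp only [hw] <;> nlinarith
  have hwc : Continuous w := by fun_prop
  have hfc : Continuous fun θ => Real.sqrt (p (w θ)) :=
    (hpc.comp_continuous hwc fun θ => hU (hwI θ)).sqrt
  obtain ⟨M, hM⟩ := (isCompact_Icc.image_of_continuousOn ((hpc.mono hU).sqrt)).bddAbove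
  obtain ⟨y, hys, hyd, hyp⟩ := exists_surjective_hasDerivAt_of_bounded hfc
    (fun θ => Real.sqrt_pos.2 (hppos _ (hwI θ))) (fun θ => hM ⟨w θ, hwI θ, rfl⟩)
  have hgd : ∀ t, HasDerivAt (fun t => w (y t))
      (-((b - a) / 2 * (-Real.sin (y t) * Real.sqrt (p (w (y t)))))) t := fun t =>
    (((hyd t).cos).const_mul _).const_sub _
  refine ⟨fun t => w (y t), fun t => (hgd t).differentiableAt, ?_, fun t => hwI _, fun t => ?_, ?_⟩
  · rintro ⟨k, hk⟩
    obtain ⟨t₀, h₀⟩ := hys 0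
    obtain ⟨t₁, h₁⟩ := hys Real.pi
    have e₀ := hk t₀
    have e₁ := hk t₁
    simp only [hw, h₀, h₁, Real.cos_zero, Real.cos_pi] at e₀ e₁
    linarith
  · rw [(hgd t).deriv, hqp]
    have h1 := Real.sq_sqrt (hppos _ (hwI (y t))).le
    have h2 : (w (y t) - a) * (b - w (y t)) = ((b - a) / 2) ^ 2 * Real.sin (y t) ^ 2 := by
      simp only [hw, Real.sin_sq]; ring
    rw [h2]
    conv_rhs => rw [← h1]
    ring
  · obtain ⟨T, hT, hTy⟩ := hyp (2 * Real.pi) Real.two_pi_pos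
      (fun θ => by simp only [hw, Real.cos_add_two_pi])
    exact ⟨T, hT, fun t => by simp only [hTy, hw, Real.cos_add_two_pi]⟩

/-- If `q` is positive and bounded to the right of a simple zero, then `(g')² = q g` has a
nonconstant global solution turning at that zero. -/
theorem exists_deriv_sq_eq_of_bounded {q : ℝ → ℝ} {U : Set ℝ} {a qa M : ℝ}
    (hU : Set.Ici a ⊆ U) (hUo : IsOpen U) (hq : ContinuousOn q U)
    (ha : q a = 0) (hpos : ∀ v, a < v → 0 < q v) (hM : ∀ v, a < v → q v ≤ M)
    (hda : HasDerivAt q qa a) (hqa : 0 < qa) :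
    ∃ g : ℝ → ℝ, Differentiable ℝ g ∧ (¬ ∃ k : ℝ, ∀ t, g t = k) ∧ (∀ t, a ≤ g t) ∧
      ∀ t, deriv g t ^ 2 = q (g t) := by
  have haU : U ∈ nhds a := hUo.mem_nhds (hU Set.self_mem_Ici)
  set p := dslope q a with hp
  have hqp : ∀ v, q v = (v - a) * p v := fun v => by
    have := sub_smul_dslope q a v
    rw [ha, sub_zero, smul_eq_mul] at this
    exact this.symm
  have hpc : ContinuousOn p U := (continuousOn_dslope haU).2 ⟨hq, hda.differentiableAt⟩
  have hppos : ∀ v, a ≤ v → 0 < p v := by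
    intro v hv
    rcases hv.eq_or_lt with rfl | hav
    · rwa [hp, dslope_same, hda.deriv]
    · have h1 := hpos v hav
      rw [hqp] at h1
      exact pos_of_mul_pos_right h1 (sub_pos.2 hav).le
  obtain ⟨K, hK⟩ := (isCompact_Icc.image_of_continuousOn
    (hpc.mono (Set.Icc_subset_Ici_self.trans hU) : ContinuousOn p (Set.Icc a (a + 1)))).bddAbove
  have hpK : ∀ v, a ≤ v → p v ≤ max K M := by
    intro v hv
    rcases le_total v (a + 1) with h1 | h1
    · exact (hK ⟨v, ⟨hv, h1⟩, rfl⟩).trans (le_max_left _ _)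
    · refine le_trans ?_ (le_max_right _ _)
      have h2 := hM v (by linarith)
      rw [hqp] at h2
      nlinarith [hppos v hv]
  have hwI : ∀ s : ℝ, a ≤ a + s ^ 2 := fun s => by nlinarith [sq_nonneg s]
  have hfc : Continuous fun s : ℝ => Real.sqrt (p (a + s ^ 2)) / 2 :=
    ((hpc.comp_continuous (by fun_prop) fun s => hU (hwI s)).sqrt).div_const 2
  obtain ⟨y, hys, hyd, -⟩ := exists_surjective_hasDerivAt_of_bounded hfc
    (fun s => half_pos (Real.sqrt_pos.2 (hppos _ (hwI s)))) (M := Real.sqrt (max K M) / 2)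
    (fun s => div_le_div_of_nonneg_right (Real.sqrt_le_sqrt (hpK _ (hwI s))) two_pos.le)
  have hgd : ∀ t, HasDerivAt (fun t => a + y t ^ 2)
      (2 * y t * (Real.sqrt (p (a + y t ^ 2)) / 2)) t := fun t => by
    simpa using ((hyd t).pow 2).const_add a
  refine ⟨fun t => a + y t ^ 2, fun t => (hgd t).differentiableAt, ?_, fun t => hwI _, fun t => ?_⟩
  · rintro ⟨k, hk⟩
    obtain ⟨t₀, h₀⟩ := hys 0
    obtain ⟨t₁, h₁⟩ := hys 1
    have e₀ := hk t₀
    have e₁ := hk t₁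
    simp only [h₀, h₁] at e₀ e₁
    linarith
  · rw [(hgd t).deriv, hqp]
    have h1 := Real.sq_sqrt (hppos _ (hwI (y t))).le
    have h2 : (a + y t ^ 2 - a) = y t ^ 2 := by ring
    rw [h2]
    conv_rhs => rw [← h1]
    ring

/-- Derivative of the potential, as a quadratic polynomial in `v⁻ⁿ`. -/
theorem hasDerivAt_sq_sub_sq_mul {n : ℕ} (hn : n ≠ 0) (h : ℝ) {v : ℝ} (hv : 0 < v) :
    HasDerivAt (fun v : ℝ => v ^ 2 - v ^ 2 * (h + (v ^ n)⁻¹) ^ 2)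
      (2 * v * (((n : ℝ) - 1) * (v ^ n)⁻¹ ^ 2 + ((n : ℝ) - 2) * h * (v ^ n)⁻¹ + (1 - h ^ 2))) v := by
  obtain ⟨m, rfl⟩ := Nat.exists_eq_succ_of_ne_zero hn
  have hu : HasDerivAt (fun v : ℝ => (v ^ (m + 1))⁻¹) _ v :=
    (hasDerivAt_pow (m + 1) v).fun_inv (pow_pos hv _).ne'
  refine ((hasDerivAt_pow 2 v).sub ((hasDerivAt_pow 2 v).mul ((hu.const_add h).fun_pow 2)))
    |>.congr_deriv ?_
  have := hv.ne'
  push_cast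
  simp only [Nat.succ_eq_add_one]
  field_simp
  ring

theorem exists_pos_inv_pow_eq {n : ℕ} (hn : n ≠ 0) {u : ℝ} (hu : 0 < u) :
    ∃ v : ℝ, 0 < v ∧ (v ^ n)⁻¹ = u :=
  ⟨u⁻¹ ^ (n : ℝ)⁻¹, Real.rpow_pos_of_pos (inv_pos.2 hu) _, by
    rw [Real.rpow_inv_natCast_pow (inv_pos.2 hu).le hn, inv_inv]⟩

/-- Theorem 3.1 of the paper (ODE content): for `n ≥ 3` and `h ∈ [-1, -2√(n-1)/n)`
there is `c > 0` and a nonconstant entire solution `g > √c` of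
`(g')² = c - g² + g²(h + g^{-n})²`; when `h > -1` the solution may be chosen periodic. -/
theorem stmt_13 (n : ℕ) (hn : 3 ≤ n) (h : ℝ)
    (hh1 : -1 ≤ h) (hh2 : h < -(2 * Real.sqrt ((n : ℝ) - 1) / n)) :
    ∃ c : ℝ, 0 < c ∧ ∃ g : ℝ → ℝ, Differentiable ℝ g ∧
      (¬ ∃ b : ℝ, ∀ t, g t = b) ∧
      (∀ t, Real.sqrt c < g t) ∧
      (∀ t, deriv g t ^ 2 = c - g t ^ 2 + g t ^ 2 * (h + g t ^ (-(n : ℤ))) ^ 2) ∧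
      (-1 < h → ∃ T > 0, Function.Periodic g T) := by
  have hn0 : n ≠ 0 := by omega
  have hN : (3 : ℝ) ≤ n := by exact_mod_cast hn
  set N : ℝ := (n : ℝ)
  have hN1 : 0 < N - 1 := by linarith
  have hdisc : 4 * (N - 1) < N ^ 2 * h ^ 2 := by
    have h1 : 2 * Real.sqrt (N - 1) < -h * N := by
      rw [← div_lt_iff₀ (by linarith)]; linarith
    have h2 := Real.sq_sqrt hN1.le
    have h3 := Real.sqrt_nonneg (N - 1)
    nlinarith
  have hneg : h < 0 := hh2.trans_le (neg_nonpos.2 (by positivity))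
  set G : ℝ → ℝ := fun u => (N - 1) * u ^ 2 + (N - 2) * h * u + (1 - h ^ 2) with hG
  set u₀ : ℝ := -((N - 2) * h) / (2 * (N - 1)) with hu₀
  have hu₀eq : 2 * (N - 1) * u₀ = -((N - 2) * h) := by rw [hu₀]; field_simp
  have hu₀pos : 0 < u₀ := div_pos (by nlinarith) (by linarith)
  have hu₀lt : h + u₀ < 0 := by
    by_contra! h1
    nlinarith [mul_nonneg hN1.le h1]
  have hGu₀ : G u₀ < 0 := by
    have h1 : 4 * (N - 1) * G u₀ = 4 * (N - 1) - N ^ 2 * h ^ 2 := by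
      simp only [hG]
      linear_combination (2 * (N - 1) * u₀ + (N - 2) * h) * hu₀eq
    by_contra! h2
    nlinarith [mul_nonneg hN1.le h2]
  obtain ⟨a, ha, hau⟩ := exists_pos_inv_pow_eq hn0 hu₀pos
  have hanti : ∀ v w : ℝ, 0 < v → v < w → (w ^ n)⁻¹ < (v ^ n)⁻¹ := fun v w hv hvw =>
    inv_strictAnti₀ (pow_pos hv n) (pow_lt_pow_left₀ hvw hv.le hn0)
  have hule : ∀ v, a ≤ v → (v ^ n)⁻¹ ≤ u₀ := by
    intro v hv
    rcases hv.eq_or_lt with rfl | h1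
    · exact hau.le
    · exact hau ▸ (hanti a v ha h1).le
  have hupos : ∀ v : ℝ, a ≤ v → 0 < (v ^ n)⁻¹ := fun v hv =>
    inv_pos.2 (pow_pos (ha.trans_le hv) n)
  set F : ℝ → ℝ := fun v => v ^ 2 - v ^ 2 * (h + (v ^ n)⁻¹) ^ 2 with hF
  have hFd : ∀ v, 0 < v → HasDerivAt F (2 * v * G (v ^ n)⁻¹) v := fun v hv =>
    hasDerivAt_sq_sub_sq_mul hn0 h hv
  have hFc : ContinuousOn F (Set.Ioi 0) := fun v hv => (hFd v hv).continuousAt.continuousWithinAt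
  have hFlower : ∀ v, a ≤ v → v ^ 2 * (1 - h ^ 2) ≤ F v := by
    intro v hv
    have h1 : (h + (v ^ n)⁻¹) ^ 2 ≤ h ^ 2 := by nlinarith [hule v hv, hupos v hv]
    simp only [hF]
    nlinarith [mul_le_mul_of_nonneg_left h1 (sq_nonneg v)]
  set c := F a with hc
  have hca : c = a ^ 2 * (1 - (h + u₀) ^ 2) := by simp only [hc, hF, hau]; ring
  have hcpos : 0 < c := hca ▸ mul_pos (pow_pos ha 2) (by nlinarith)
  have hcv : ∀ v, a ≤ v → Real.sqrt c < v := by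
    intro v hv
    rw [Real.sqrt_lt' (ha.trans_le hv), hca]
    nlinarith [mul_pos (pow_pos ha 2) (pow_pos (neg_pos.2 hu₀lt) 2)]
  have hode : ∀ v : ℝ, c - F v = c - v ^ 2 + v ^ 2 * (h + v ^ (-(n : ℤ))) ^ 2 := fun v => by
    simp only [hF, zpow_neg, zpow_natCast]; ring
  have hqc : ContinuousOn (fun v => c - F v) (Set.Ioi 0) := continuousOn_const.sub hFc
  have hqd : ∀ v, 0 < v → HasDerivAt (fun v => c - F v) (-(2 * v * G (v ^ n)⁻¹)) v := fun v hv =>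
    (hFd v hv).const_sub c
  have hqda : 0 < -(2 * a * G (a ^ n)⁻¹) := by
    rw [hau]; nlinarith [mul_pos ha (neg_pos.2 hGu₀)]
  refine ⟨c, hcpos, ?_⟩
  rcases hh1.eq_or_lt with heq | hlt
  · have hFanti : StrictAntiOn F (Set.Ici a) := by
      refine strictAntiOn_of_deriv_neg (convex_Ici a)
        (hFc.mono fun v hv => ha.trans_le hv) fun v hv => ?_
      rw [interior_Ici] at hv
      have hv : a < v := hv
      rw [(hFd v (ha.trans hv)).deriv]
      refine mul_neg_of_pos_of_neg (by linarith) ?_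
      have h1 : G (v ^ n)⁻¹ = (v ^ n)⁻¹ * ((N - 1) * (v ^ n)⁻¹ - (N - 2)) := by
        simp only [hG, ← heq]; ring
      rw [h1]
      refine mul_neg_of_pos_of_neg (hupos v hv.le) ?_
      rw [← heq] at hu₀eq
      nlinarith [mul_le_mul_of_nonneg_left (hule v hv.le) hN1.le]
    obtain ⟨g, hg, hgn, hga, hgq⟩ := exists_deriv_sq_eq_of_bounded (q := fun v => c - F v)
      (a := a) (M := c) (fun v hv => ha.trans_le hv) isOpen_Ioi hqc (sub_self c)
      (fun v hv => sub_pos.2 (hFanti Set.self_mem_Ici hv.le hv))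
      (fun v hv => by
        have h1 := hFlower v hv.le
        rw [← heq] at h1
        linarith)
      (hqd a ha) hqda
    exact ⟨g, hg, hgn, fun t => hcv _ (hga t), fun t => by rw [hgq t, hode],
      fun h1 => absurd heq h1.ne⟩
  · have hh : 0 < 1 - h ^ 2 := by nlinarith
    obtain ⟨u₁, ⟨hu₁pos, hu₁lt⟩, hGu₁⟩ : ∃ u ∈ Set.Ioo 0 u₀, G u = 0 := by
      have := intermediate_value_Ioo' hu₀pos.le (f := G) (by fun_prop)
      exact this ⟨hGu₀, by simpa [hG] using hh⟩
    have hGfac : ∀ u, G u = (u - u₁) * ((N - 1) * (u + u₁) + (N - 2) * h) := fun u => by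
      rw [← sub_zero (G u), ← hGu₁]; simp only [hG]; ring
    have hfac : ∀ u ≤ u₀, (N - 1) * (u + u₁) + (N - 2) * h < 0 := fun u hu => by
      nlinarith [mul_pos hN1 (sub_pos.2 hu₁lt), mul_nonneg hN1.le (sub_nonneg.2 hu)]
    obtain ⟨m, hm, hmu⟩ := exists_pos_inv_pow_eq hn0 hu₁pos
    have ham : a < m := by
      by_contra! h1
      rcases h1.eq_or_lt with rfl | h1
      · linarith
      · linarith [hanti m a hm h1]
    have hFanti : StrictAntiOn F (Set.Icc a m) := by
      refine strictAntiOn_of_deriv_neg (convex_Icc a m)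
        (hFc.mono fun v hv => ha.trans_le hv.1) fun v hv => ?_
      rw [interior_Icc] at hv
      have hv0 := ha.trans hv.1
      rw [(hFd v hv0).deriv, hGfac]
      have h1 := hanti v m hv0 hv.2
      exact mul_neg_of_pos_of_neg (by linarith)
        (mul_neg_of_pos_of_neg (by linarith) (hfac _ (hule v hv.1.le)))
    have hGpos : ∀ v, m < v → 0 < 2 * v * G (v ^ n)⁻¹ := by
      intro v hv
      have h1 := hanti m v hm hv
      rw [hGfac]
      exact mul_pos (by linarith)
        (mul_pos_of_neg_of_neg (by linarith) (hfac _ (hule v (ham.trans hv).le)))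
    have hFmono : StrictMonoOn F (Set.Ici m) := by
      refine strictMonoOn_of_deriv_pos (convex_Ici m)
        (hFc.mono fun v hv => hm.trans_le hv) fun v hv => ?_
      rw [interior_Ici] at hv
      rw [(hFd v (hm.trans hv)).deriv]
      exact hGpos v hv
    have hFm : F m < c := hFanti ⟨le_rfl, ham.le⟩ ⟨ham.le, le_rfl⟩ ham
    obtain ⟨X, hmX, hFX⟩ : ∃ X, m ≤ X ∧ c < F X := by
      have hd : 0 < c / (1 - h ^ 2) := div_pos hcpos hh
      refine ⟨m + c / (1 - h ^ 2) + 1, by linarith, ?_⟩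
      refine lt_of_lt_of_le ?_ (hFlower _ (by linarith))
      rw [← div_lt_iff₀ hh]
      nlinarith
    obtain ⟨b, hb, hFb⟩ := intermediate_value_Ioo hmX
      (hFc.mono fun v hv => hm.trans_le hv.1) ⟨hFm, hFX⟩
    have hab : a < b := ham.trans hb.1
    obtain ⟨g, hg, hgn, hga, hgq, hper⟩ := exists_periodic_deriv_sq_eq (q := fun v => c - F v)
      (U := Set.Ioi 0) hab (fun v hv => ha.trans_le hv.1) isOpen_Ioi hqc (sub_self c)
      (sub_eq_zero.2 hFb.symm)
      (fun v hv => by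
        rcases le_total v m with h1 | h1
        · exact sub_pos.2 (hFanti ⟨le_rfl, ham.le⟩ ⟨hv.1.le, h1⟩ hv.1)
        · exact sub_pos.2 (hFb ▸ hFmono h1 hb.1.le hv.2))
      (hqd a ha) hqda (hqd b (ha.trans hab)) (neg_neg_of_pos (hGpos b hb.1))
    exact ⟨g, hg, hgn, fun t => hcv _ (hga t).1, fun t => by rw [hgq t, hode], fun _ => hper⟩
end

section
/- Let $n\ge 2$ be an integer and let $h\in\mathbb{R}$ with $|h|>1$. Then there exist a real number $c<0$ and a nonconstant differentiable function $g:\mathbb{R}\to\mathbb{R}$ such that $\inf_{t\in\mathbb{R}} g(t) > 0$ and $(g'(t))^2 = c - g(t)^2 + g(t)^2\,(h+g(t)^{-n})^2$ for all $t\in\mathbb{R}$. -/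
/-- The autonomous equation `u' = φ(u)` with `φ` continuous, positive and bounded has a global
surjective solution. -/
theorem exists_surjective_hasDerivAt_of_continuous_pos_le {φ : ℝ → ℝ} {b : ℝ}
    (hφ : Continuous φ) (hpos : ∀ x, 0 < φ x) (hb : ∀ x, φ x ≤ b) :
    ∃ u : ℝ → ℝ, Function.Surjective u ∧ ∀ t, HasDerivAt u (φ (u t)) t := by
  have hb0 : 0 < b := (hpos 0).trans_le (hb 0)
  have hc : Continuous fun x => (φ x)⁻¹ := hφ.inv₀ fun x => (hpos x).ne'
  set T : ℝ → ℝ := fun x => ∫ s in (0 : ℝ)..x, (φ s)⁻¹ with hT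
  have hTd : ∀ x, HasDerivAt T (φ x)⁻¹ x := fun x =>
    intervalIntegral.integral_hasDerivAt_right (hc.intervalIntegrable _ _)
      hc.aestronglyMeasurable.stronglyMeasurableAtFilter hc.continuousAt
  have hTc : Continuous T := continuous_iff_continuousAt.2 fun x => (hTd x).continuousAt
  have hTm : StrictMono T := strictMono_of_hasDerivAt_pos hTd fun x => inv_pos.2 (hpos x)
  have hmono : Monotone fun x => T x - b⁻¹ * x := by
    have hd : ∀ x, HasDerivAt (fun x => T x - b⁻¹ * x) ((φ x)⁻¹ - b⁻¹ * 1) x := fun x =>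
      (hTd x).sub ((hasDerivAt_id x).const_mul b⁻¹)
    refine monotone_of_deriv_nonneg (fun x => (hd x).differentiableAt) fun x => ?_
    rw [(hd x).deriv, mul_one, sub_nonneg]
    exact inv_anti₀ (hpos x) (hb x)
  have hT0 : T 0 = 0 := by simp [hT]
  have htop : Filter.Tendsto T Filter.atTop Filter.atTop := by
    refine Filter.tendsto_atTop_mono' _ ?_
      (Filter.tendsto_id.const_mul_atTop (inv_pos.2 hb0))
    filter_upwards [Filter.eventually_ge_atTop 0] with x hx
    have := hmono hx
    simp only [hT0, mul_zero, sub_zero] at this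
    simpa using this
  have hbot : Filter.Tendsto T Filter.atBot Filter.atBot := by
    refine Filter.tendsto_atBot_mono' _ ?_
      (Filter.tendsto_id.const_mul_atBot (inv_pos.2 hb0))
    filter_upwards [Filter.eventually_le_atBot 0] with x hx
    have := hmono hx
    simp only [hT0, mul_zero, sub_zero] at this
    simpa using this
  let e : ℝ ≃o ℝ := hTm.orderIsoOfSurjective T (hTc.surjective htop hbot)
  refine ⟨e.symm, e.symm.surjective, fun t => ?_⟩
  have key := HasDerivAt.of_local_left_inverse (f := T) (g := e.symm) (a := t)
    e.symm.continuous.continuousAt (hTd _) (inv_pos.2 (hpos _)).ne'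
    (Filter.Eventually.of_forall fun y => e.apply_symm_apply y)
  simpa using key

/-- If `p' = q` on `[y₀, ∞)`, every value of `dslope p y₀` there is a value of `q`. -/
theorem exists_dslope_eq_of_hasDerivAt {p q : ℝ → ℝ} {y₀ y : ℝ}
    (hp : ∀ x, y₀ ≤ x → HasDerivAt p (q x) x) (hy : y₀ ≤ y) :
    ∃ x, y₀ ≤ x ∧ dslope p y₀ y = q x := by
  rcases hy.eq_or_lt with rfl | hlt
  · exact ⟨y₀, le_rfl, by rw [dslope_same, (hp y₀ le_rfl).deriv]⟩
  · obtain ⟨x, hx, he⟩ := exists_hasDerivAt_eq_slope p q hlt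
      (fun x hx => (hp x hx.1).continuousAt.continuousWithinAt) fun x hx => hp x hx.1.le
    exact ⟨x, hx.1.le, by rw [dslope_of_ne _ hlt.ne', slope_def_field, he]⟩

/-- If `p' ∈ (0, b]` on `[r², ∞)`, then `(g')² = p(g²) - p(r²)` has a nonconstant global
solution `g ≥ r`. -/
theorem exists_deriv_sq_eq_sub {p q : ℝ → ℝ} {r b : ℝ} (hr : 0 < r)
    (hp : ∀ x, r ^ 2 ≤ x → HasDerivAt p (q x) x) (hq : ∀ x, r ^ 2 ≤ x → 0 < q x ∧ q x ≤ b) :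
    ∃ g : ℝ → ℝ, Differentiable ℝ g ∧ (¬ ∃ a : ℝ, ∀ t, g t = a) ∧ (∀ t, r ≤ g t) ∧
      ∀ t, deriv g t ^ 2 = p (g t ^ 2) - p (r ^ 2) := by
  have hle : ∀ u, r ^ 2 ≤ (r * Real.cosh u) ^ 2 := fun u =>
    pow_le_pow_left₀ hr.le (le_mul_of_one_le_right hr.le (Real.one_le_cosh u)) 2
  have hbd : ∀ u, 0 < dslope p (r ^ 2) ((r * Real.cosh u) ^ 2) ∧
      dslope p (r ^ 2) ((r * Real.cosh u) ^ 2) ≤ b := fun u => by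
    obtain ⟨x, hx, he⟩ := exists_dslope_eq_of_hasDerivAt hp (hle u)
    exact he ▸ hq x hx
  have hcont : Continuous fun u => dslope p (r ^ 2) ((r * Real.cosh u) ^ 2) := by
    have hcu : Continuous fun u => (r * Real.cosh u) ^ 2 := by fun_prop
    refine continuous_iff_continuousAt.2 fun u => ContinuousAt.comp (g := dslope p (r ^ 2)) ?_
      hcu.continuousAt
    rcases eq_or_ne ((r * Real.cosh u) ^ 2) (r ^ 2) with he | hne
    · rw [he]
      exact continuousAt_dslope_same.2 (hp _ le_rfl).differentiableAt
    · exact (continuousAt_dslope_of_ne hne).2 (hp _ (hle u)).continuousAt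
  obtain ⟨u, hus, hu⟩ := exists_surjective_hasDerivAt_of_continuous_pos_le hcont.sqrt
    (fun x => Real.sqrt_pos.2 (hbd x).1) fun x => Real.sqrt_le_sqrt (hbd x).2
  have hg : ∀ t, HasDerivAt (fun t => r * Real.cosh (u t)) _ t := fun t =>
    (hu t).cosh.const_mul r
  refine ⟨fun t => r * Real.cosh (u t), fun t => (hg t).differentiableAt, ?_, fun t =>
    le_mul_of_one_le_right hr.le (Real.one_le_cosh _), fun t => ?_⟩
  · rintro ⟨a, ha⟩
    obtain ⟨t₀, h₀⟩ := hus 0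
    obtain ⟨t₁, h₁⟩ := hus 1
    have h := mul_left_cancel₀ hr.ne' ((ha t₁).trans (ha t₀).symm)
    rw [h₀, h₁, Real.cosh_zero] at h
    exact (Real.one_lt_cosh.2 one_ne_zero).ne' h
  · rw [(hg t).deriv]
    have hd := sub_smul_dslope p (r ^ 2) ((r * Real.cosh (u t)) ^ 2)
    rw [smul_eq_mul] at hd
    rw [← hd, mul_pow, mul_pow, Real.sq_sqrt (hbd _).1.le, mul_pow, Real.cosh_sq]
    ring

/-- Theorem 3.3 of the paper (ODE content): for `n ≥ 2` and `|h| > 1` there is a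
`c < 0` and a nonconstant entire solution `g`, bounded away from `0`, of
`(g')² = c - g² + g²(h + g^{-n})²`. -/
theorem stmt_17 (n : ℕ) (hn : 2 ≤ n) (h : ℝ) (hh : 1 < |h|) :
    ∃ c : ℝ, c < 0 ∧ ∃ g : ℝ → ℝ, Differentiable ℝ g ∧
      (¬ ∃ b : ℝ, ∀ t, g t = b) ∧
      (∃ δ : ℝ, 0 < δ ∧ ∀ t, δ ≤ g t) ∧
      (∀ t, deriv g t ^ 2 = c - g t ^ 2 + g t ^ 2 * (h + g t ^ (-(n : ℤ))) ^ 2) := by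
  have hh' : 0 < h ^ 2 - 1 := by
    have := (one_lt_sq_iff_one_lt_abs h).2 hh
    linarith
  set m : ℝ := n / 2 with hm
  have hm0 : 0 < m := by positivity
  let p : ℝ → ℝ := fun y => y * ((h + y ^ (-m)) ^ 2 - 1)
  let q : ℝ → ℝ := fun y => (h + y ^ (-m)) ^ 2 - 1 - 2 * m * y ^ (-m) * (h + y ^ (-m))
  have hpd : ∀ y, 0 < y → HasDerivAt p (q y) y := fun y hy => by
    have hs := Real.hasDerivAt_rpow_const (x := y) (p := -m) (Or.inl hy.ne')
    have := (hasDerivAt_id y).mul (((hs.const_add h).pow 2).sub_const 1)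
    refine this.congr_deriv ?_
    have he : y ^ (-m) = y * y ^ (-m - 1) := by
      rw [Real.rpow_sub_one hy.ne']
      field_simp
    simp only [q, id, Pi.pow_apply, he]
    push_cast
    ring
  have hs : Filter.Tendsto (fun y : ℝ => y ^ (-m)) Filter.atTop (nhds 0) :=
    tendsto_rpow_neg_atTop hm0
  have hA : Filter.Tendsto (fun y : ℝ => (h + y ^ (-m)) ^ 2 - 1) Filter.atTop
      (nhds (h ^ 2 - 1)) := by
    simpa using ((hs.const_add h).pow 2).sub_const 1
  have hQ : Filter.Tendsto q Filter.atTop (nhds (h ^ 2 - 1)) := by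
    simpa using hA.sub ((hs.const_mul (2 * m)).mul (hs.const_add h))
  obtain ⟨r, hr⟩ := Filter.eventually_atTop.1 (((hA.eventually_const_lt hh').and
    ((hQ.eventually_const_lt hh').and (hQ.eventually_le_const (lt_add_one _)))))
  set R : ℝ := max r 1
  have hR1 : 1 ≤ R := le_max_right _ _
  have hR0 : 0 < R := by linarith
  have hRr : ∀ x, R ^ 2 ≤ x → r ≤ x := fun x hx => by
    have : r ≤ R := le_max_left _ _
    nlinarith
  obtain ⟨g, hgd, hgc, hgR, hg⟩ := exists_deriv_sq_eq_sub (p := p) (q := q) hR0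
    (fun x hx => hpd x ((pow_pos hR0 2).trans_le hx)) fun x hx => (hr x (hRr x hx)).2
  refine ⟨-p (R ^ 2), neg_lt_zero.2 (mul_pos (pow_pos hR0 2) (hr _ (hRr _ le_rfl)).1), g, hgd,
    hgc, ⟨R, hR0, hgR⟩, fun t => ?_⟩
  have hgt : 0 < g t := hR0.trans_le (hgR t)
  have he : (g t ^ 2) ^ (-m) = g t ^ (-(n : ℤ)) := by
    rw [← Real.rpow_natCast, ← Real.rpow_mul hgt.le, ← Real.rpow_intCast]
    congr 1
    rw [hm]
    push_cast
    ring
  rw [hg t, ← he]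
  simp only [p]
  ring
end
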